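/- arXiv:2209.09573 — 2 statements merged into one kernel-verified Lean document; each statement's English description precedes it below -/
import Mathlib

section
/- Assume the generalized moment problem is feasible, the Slater-type condition holds (there exist scalars z_0, z_1,…,z_N ∈ ℝ with z_0 f_0(x) + Σ_{i=1}^N z_i f_i(x) > 0 for all x ∈ K), and the quadratic module M(g) is Archimedean (R − Σ_{i=1}^n x_i² ∈ M(g) for some scalar R > 0). Then the ideal-sparse moment bounds converge: lim_{t→∞} ξ^isp_t = val. -/
open MvPolynomial MeasureTheory

/-- Substituting `0` for the variables outside `U` (the restriction `f ↦ f|U`). -/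
noncomputable def restrictVars {n : ℕ} (U : Finset (Fin n)) :
    MvPolynomial (Fin n) ℝ →ₐ[ℝ] MvPolynomial (Fin n) ℝ :=
  aeval (fun i => if i ∈ U then (X i : MvPolynomial (Fin n) ℝ) else 0)

/-- Membership in the truncated quadratic module `M(g|U)_{2t}`, with sums of squares of
polynomials in the variables `x(U)`. -/
def inTruncModuleRes {n m : ℕ} (U : Finset (Fin n))
    (g : Fin m → MvPolynomial (Fin n) ℝ) (t : ℕ) (q : MvPolynomial (Fin n) ℝ) : Prop :=
  ∃ σ : Fin (m + 1) → MvPolynomial (Fin n) ℝ,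
    (∀ j, IsSumSq (σ j) ∧ restrictVars U (σ j) = σ j) ∧
    (∀ j, (σ j * restrictVars U ((Fin.cons 1 g : Fin (m + 1) → MvPolynomial (Fin n) ℝ) j)).totalDegree ≤ 2 * t) ∧
    q = ∑ j, σ j * restrictVars U ((Fin.cons 1 g : Fin (m + 1) → MvPolynomial (Fin n) ℝ) j)


theorem sum_extend_zero {ι κ F : Type*} [Fintype ι] [Fintype κ] [AddCommMonoid F] (e : ι ↪ κ)
    (u : ι → F) : ∑ j, Function.extend e u 0 j = ∑ i, u i := by
  rw [← Finset.sum_subset (Finset.subset_univ (Finset.univ.map e)), Finset.sum_map]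
  · simp [e.injective.extend_apply]
  · intro j _ hj
    rw [Function.extend_apply' _ _ _ (by simpa using hj)]
    rfl

/-- In a finite-dimensional space the convex hull of a compact set is compact. -/
theorem isCompact_convexHull_of_finiteDimensional {E : Type*} [AddCommGroup E] [Module ℝ E]
    [TopologicalSpace E] [IsTopologicalAddGroup E] [ContinuousSMul ℝ E] [FiniteDimensional ℝ E]
    {s : Set E} (hs : IsCompact s) : IsCompact (convexHull ℝ s) := by
  classical
  let d := Module.finrank ℝ E + 1
  let Φ : (Fin d → ℝ) × (Fin d → E) → E := fun y => ∑ i, y.1 i • y.2 i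
  have hΦ : Continuous Φ := by fun_prop
  have hcomp : IsCompact (Φ '' (stdSimplex ℝ (Fin d) ×ˢ Set.univ.pi fun _ => s)) :=
    ((isCompact_stdSimplex ℝ (Fin d)).prod (isCompact_univ_pi fun _ => hs)).image hΦ
  convert hcomp using 1
  apply Set.Subset.antisymm
  · intro x hx
    obtain ⟨ι, _, z, w, hz, hind, hw, hw1, rfl⟩ := eq_pos_convex_span_of_mem_convexHull hx
    have hcard : Fintype.card ι ≤ d := hind.card_le_finrank_succ.trans
      (Nat.succ_le_succ (Submodule.finrank_le _))
    obtain ⟨e⟩ : Nonempty (ι ↪ Fin d) := Function.Embedding.nonempty_of_card_le (by simpa)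
    have hne : Nonempty ι := by
      by_contra h
      rw [not_nonempty_iff] at h
      simp at hw1
    obtain ⟨i₀⟩ := hne
    refine ⟨(Function.extend e w 0, Function.extend e z fun _ => z i₀), ⟨⟨fun j => ?_, ?_⟩, ?_⟩, ?_⟩
    · by_cases hj : ∃ i, e i = j
      · obtain ⟨i, rfl⟩ := hj
        simpa [e.injective.extend_apply] using (hw i).le
      · simp [Function.extend_apply' _ _ _ hj]
    · simpa [sum_extend_zero] using hw1
    · intro j _
      by_cases hj : ∃ i, e i = j
      · obtain ⟨i, rfl⟩ := hj
        simpa [e.injective.extend_apply] using hz ⟨i, rfl⟩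
      · simpa [Function.extend_apply' _ _ _ hj] using hz ⟨i₀, rfl⟩
    · rw [← sum_extend_zero e]
      refine Finset.sum_congr rfl fun j _ => ?_
      by_cases hj : ∃ i, e i = j
      · obtain ⟨i, rfl⟩ := hj
        simp [e.injective.extend_apply]
      · simp [Function.extend_apply' _ _ _ hj]
  · rintro _ ⟨⟨w, z⟩, ⟨hw, hz⟩, rfl⟩
    exact (convex_convexHull ℝ s).sum_mem (fun i _ => hw.1 i) hw.2
      fun i _ => subset_convexHull ℝ s (hz i trivial)

/-- A log-convex nonnegative sequence of growth at most `C * R ^ k` satisfies `c 1 ≤ R * c 0`. -/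
theorem le_mul_of_logConvex_of_le_geometric {c : ℕ → ℝ} {C R : ℝ} (hR : 0 < R)
    (h0 : ∀ k, 0 ≤ c k) (hlog : ∀ k, c (k + 1) ^ 2 ≤ c k * c (k + 2))
    (hgrow : ∀ k, c k ≤ C * R ^ k) : c 1 ≤ R * c 0 := by
  by_contra! hlt
  have hc0 : 0 < c 0 := by
    rcases (h0 0).eq_or_lt with h | h
    · have := hlog 0
      rw [← h] at this hlt
      simp only [zero_add] at this
      nlinarith
    · exact h
  set ρ := c 1 / c 0 with hρ
  have hρR : R < ρ := by rwa [hρ, lt_div_iff₀ hc0]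
  have hρ0 : 0 < ρ := hR.trans hρR
  have hstep : ∀ k, 0 < c k ∧ ρ * c k ≤ c (k + 1) := by
    intro k
    induction k with
    | zero => exact ⟨hc0, by rw [hρ]; field_simp; simp⟩
    | succ k ih =>
      obtain ⟨hk, hk'⟩ := ih
      have hk1 : 0 < c (k + 1) := (mul_pos hρ0 hk).trans_le hk'
      refine ⟨hk1, ?_⟩
      have h2 := hlog k
      have h3 : (ρ * c k) * c (k + 1) ≤ c (k + 1) ^ 2 := by nlinarith
      have h4 : c k * (ρ * c (k + 1)) ≤ c k * c (k + 2) := by nlinarith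
      exact le_of_mul_le_mul_left h4 hk
  have hlow : ∀ k, c 0 * ρ ^ k ≤ c k := by
    intro k
    induction k with
    | zero => simp
    | succ k ih =>
      calc c 0 * ρ ^ (k + 1) = ρ * (c 0 * ρ ^ k) := by ring
        _ ≤ ρ * c k := by gcongr
        _ ≤ _ := (hstep k).2
  have h1 : 1 < ρ / R := by rwa [one_lt_div hR]
  obtain ⟨k, hk⟩ := pow_unbounded_of_one_lt (C / c 0) h1
  rw [div_pow, div_lt_div_iff₀ hc0 (by positivity)] at hk
  linarith [hlow k, hgrow k, mul_comm (c 0) (ρ ^ k)]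

/-- Cauchy–Schwarz for a linear functional that is nonnegative on squares. -/
theorem LinearMap.apply_mul_sq_le {A : Type*} [CommRing A] [Algebra ℝ A] (l : A →ₗ[ℝ] ℝ)
    (hl : ∀ p, 0 ≤ l (p ^ 2)) (p q : A) : l (p * q) ^ 2 ≤ l (p ^ 2) * l (q ^ 2) := by
  have h : ∀ x : ℝ, 0 ≤ l (p ^ 2) * (x * x) + 2 * l (p * q) * x + l (q ^ 2) := by
    intro x
    have := hl (x • p + q)
    have e : (x • p + q) ^ 2 = (x * x) • p ^ 2 + (2 * x) • (p * q) + q ^ 2 := by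
      simp only [Algebra.smul_def, map_mul, map_ofNat]; ring
    rw [e] at this
    simp only [map_add, map_smul, smul_eq_mul] at this
    linarith
  have := discrim_le_zero h
  simp only [discrim] at this
  linarith

/-- The functional `q ↦ l (h * q)`. -/
noncomputable def LinearMap.mulShift {A : Type*} [CommRing A] [Algebra ℝ A] (l : A →ₗ[ℝ] ℝ)
    (h : A) : A →ₗ[ℝ] ℝ := l ∘ₗ LinearMap.mulLeft ℝ h

@[simp]
theorem LinearMap.mulShift_apply {A : Type*} [CommRing A] [Algebra ℝ A] (l : A →ₗ[ℝ] ℝ)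
    (h q : A) : l.mulShift h q = l (h * q) := rfl

/-- If `l` is nonnegative on squares and on `h` times squares, and `r² - s²` times squares,
then it is nonnegative on `h * (r² - s²)` times squares. -/
theorem LinearMap.apply_mul_sq_sq_le {A : Type*} [CommRing A] [Algebra ℝ A] (l : A →ₗ[ℝ] ℝ)
    {h s : A} {r : ℝ} (hr : 0 < r) (hl : ∀ p, 0 ≤ l (p ^ 2)) (hh : ∀ p, 0 ≤ l (h * p ^ 2))
    (hs : ∀ p, l (s ^ 2 * p ^ 2) ≤ r ^ 2 * l (p ^ 2)) (p : A) :
    l (h * (s ^ 2 * p ^ 2)) ≤ r ^ 2 * l (h * p ^ 2) := by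
  have hpow : ∀ k, l (s ^ (2 * k)) ≤ (r ^ 2) ^ k * l 1 := by
    intro k
    induction k with
    | zero => simp
    | succ k ih =>
      have := hs (s ^ k)
      calc l (s ^ (2 * (k + 1))) = l (s ^ 2 * (s ^ k) ^ 2) := by congr 1; ring
        _ ≤ r ^ 2 * l ((s ^ k) ^ 2) := this
        _ = r ^ 2 * l (s ^ (2 * k)) := by congr 2; ring
        _ ≤ r ^ 2 * ((r ^ 2) ^ k * l 1) := by gcongr
        _ = _ := by ring
  set D := l 1 * l ((h * p ^ 2) ^ 2) with hD
  have hD0 : 0 ≤ D := mul_nonneg (by simpa using hl 1) (hl _)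
  have key := le_mul_of_logConvex_of_le_geometric (c := fun k => l (h * (s ^ k * p) ^ 2))
    (C := √D) (R := r ^ 2) (by positivity) (fun k => hh _) (fun k => ?_) (fun k => ?_)
  · simpa [mul_pow] using key
  · have := (l.mulShift h).apply_mul_sq_le hh (s ^ k * p) (s ^ (k + 2) * p)
    simp only [LinearMap.mulShift_apply] at this
    convert this using 3
    ring
  · have h1 := l.apply_mul_sq_le hl (s ^ (2 * k)) (h * p ^ 2)
    have h2 := hpow (2 * k)
    have e1 : (s ^ (2 * k)) ^ 2 = s ^ (2 * (2 * k)) := by ring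
    have e2 : s ^ (2 * k) * (h * p ^ 2) = h * (s ^ k * p) ^ 2 := by ring
    rw [e1, e2] at h1
    refine pow_le_pow_iff_left₀ (hh _) (by positivity) two_ne_zero |>.1 ?_
    calc _ ≤ _ := h1
      _ ≤ ((r ^ 2) ^ (2 * k) * l 1) * l ((h * p ^ 2) ^ 2) := by
        gcongr
        exact hl _
      _ = (√D * (r ^ 2) ^ k) ^ 2 := by
        rw [mul_pow (√D), Real.sq_sqrt hD0, hD]; ring

/-- Under the same hypotheses, `l` is nonnegative on `h * (r + s)` times squares. -/
theorem LinearMap.apply_mul_add_nonneg {A : Type*} [CommRing A] [Algebra ℝ A] (l : A →ₗ[ℝ] ℝ)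
    {h s : A} {r : ℝ} (hr : 0 < r) (hl : ∀ p, 0 ≤ l (p ^ 2)) (hh : ∀ p, 0 ≤ l (h * p ^ 2))
    (hs : ∀ p, l (s ^ 2 * p ^ 2) ≤ r ^ 2 * l (p ^ 2)) (p : A) :
    0 ≤ l (h * ((algebraMap ℝ A r + s) * p ^ 2)) := by
  have h1 := l.apply_mul_sq_sq_le hr hl hh hs p
  have h2 := hh (algebraMap ℝ A r * p + s * p)
  have e : h * (algebraMap ℝ A r * p + s * p) ^ 2
      = (2 * r) • (h * ((algebraMap ℝ A r + s) * p ^ 2)) - (r ^ 2) • (h * p ^ 2)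
        + h * (s ^ 2 * p ^ 2) := by
    simp only [Algebra.smul_def, map_mul, map_ofNat, map_pow]; ring
  rw [e] at h2
  simp only [map_add, map_sub, map_smul, smul_eq_mul] at h2
  by_contra! hneg
  nlinarith

/-- Functionals that are eventually nonnegative on squares and on `r² - xᵢ²` times squares are
eventually bounded at every polynomial by a constant times their value at `1`. -/
theorem exists_eventually_apply_sq_mul_sq_le {σ T : Type*} (l : Filter T)
    (L : T → MvPolynomial σ ℝ →ₗ[ℝ] ℝ) {r : ℝ}
    (hsq : ∀ p, ∀ᶠ t in l, 0 ≤ L t (p ^ 2))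
    (hbd : ∀ i p, ∀ᶠ t in l, L t (X i ^ 2 * p ^ 2) ≤ r ^ 2 * L t (p ^ 2))
    (q : MvPolynomial σ ℝ) :
    ∃ B : ℝ, 0 ≤ B ∧ ∀ p, ∀ᶠ t in l, L t (q ^ 2 * p ^ 2) ≤ B * L t (p ^ 2) := by
  induction q using MvPolynomial.induction_on with
  | C a =>
    refine ⟨a ^ 2, sq_nonneg a, fun p => Filter.Eventually.of_forall fun t => ?_⟩
    rw [← C_pow, ← smul_eq_C_mul, map_smul, smul_eq_mul]
  | add q₁ q₂ h₁ h₂ =>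
    obtain ⟨B₁, hB₁, h₁⟩ := h₁
    obtain ⟨B₂, hB₂, h₂⟩ := h₂
    refine ⟨2 * B₁ + 2 * B₂, by positivity, fun p => ?_⟩
    filter_upwards [h₁ p, h₂ p, hsq ((q₁ - q₂) * p)] with t h₁ h₂ h
    have e : ((q₁ - q₂) * p) ^ 2 = (2 : ℝ) • (q₁ ^ 2 * p ^ 2) + (2 : ℝ) • (q₂ ^ 2 * p ^ 2)
        - (q₁ + q₂) ^ 2 * p ^ 2 := by
      simp only [Algebra.smul_def, map_ofNat]; ring
    rw [e] at h
    simp only [map_add, map_sub, map_smul, smul_eq_mul] at h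
    linarith
  | mul_X q i h =>
    obtain ⟨B, hB, h⟩ := h
    refine ⟨B * r ^ 2, by positivity, fun p => ?_⟩
    filter_upwards [h (X i * p), hbd i p] with t h h'
    calc L t ((q * X i) ^ 2 * p ^ 2) = L t (q ^ 2 * (X i * p) ^ 2) := by congr 1; ring
      _ ≤ B * L t ((X i * p) ^ 2) := h
      _ = B * L t (X i ^ 2 * p ^ 2) := by congr 2; ring
      _ ≤ B * (r ^ 2 * L t (p ^ 2)) := by gcongr
      _ = _ := by ring

theorem exists_eventually_abs_apply_le {σ T : Type*} (l : Filter T)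
    (L : T → MvPolynomial σ ℝ →ₗ[ℝ] ℝ) {r : ℝ}
    (hsq : ∀ p, ∀ᶠ t in l, 0 ≤ L t (p ^ 2))
    (hbd : ∀ i p, ∀ᶠ t in l, L t (X i ^ 2 * p ^ 2) ≤ r ^ 2 * L t (p ^ 2))
    (q : MvPolynomial σ ℝ) :
    ∃ B : ℝ, 0 ≤ B ∧ ∀ᶠ t in l, |L t q| ≤ B * L t 1 := by
  obtain ⟨B, hB, h⟩ := exists_eventually_apply_sq_mul_sq_le l L hsq hbd q
  refine ⟨(1 + B) / 2, by positivity, ?_⟩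
  filter_upwards [h 1, hsq (1 + q), hsq (1 - q)] with t h h₁ h₂
  have e₁ : (1 + q) ^ 2 = 1 + (2 : ℝ) • q + q ^ 2 := by
    simp only [Algebra.smul_def, map_ofNat]; ring
  have e₂ : (1 - q) ^ 2 = 1 - (2 : ℝ) • q + q ^ 2 := by
    simp only [Algebra.smul_def, map_ofNat]; ring
  rw [e₁] at h₁
  rw [e₂] at h₂
  simp only [map_add, map_sub, map_smul, smul_eq_mul, one_pow, mul_one] at h h₁ h₂
  rw [abs_le]
  constructor <;> linarith

/-- The functionals on polynomials that are nonnegative on the quadratic module generated by `S`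
and take the value `1` at `1`. -/
def moduleStates {σ : Type*} (S : Set (MvPolynomial σ ℝ)) : Set (MvPolynomial σ ℝ → ℝ) :=
  {φ | ∃ L : MvPolynomial σ ℝ →ₗ[ℝ] ℝ, L = φ ∧ L 1 = 1 ∧ ∀ h ∈ S, ∀ p, 0 ≤ L (h * p ^ 2)}

section

variable {σ : Type*} {S : Set (MvPolynomial σ ℝ)} {r : ℝ}

theorem apply_sq_nonneg (h1 : 1 ∈ S) {L : MvPolynomial σ ℝ →ₗ[ℝ] ℝ}
    (hL : ∀ h ∈ S, ∀ p, 0 ≤ L (h * p ^ 2)) (p : MvPolynomial σ ℝ) : 0 ≤ L (p ^ 2) := by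
  simpa using hL 1 h1 p

theorem apply_X_sq_mul_sq_le (hX : ∀ i, C (r ^ 2) - X i ^ 2 ∈ S)
    {L : MvPolynomial σ ℝ →ₗ[ℝ] ℝ} (hL : ∀ h ∈ S, ∀ p, 0 ≤ L (h * p ^ 2)) (i : σ)
    (p : MvPolynomial σ ℝ) : L (X i ^ 2 * p ^ 2) ≤ r ^ 2 * L (p ^ 2) := by
  have := hL _ (hX i) p
  rw [sub_mul, map_sub, ← smul_eq_C_mul, map_smul, smul_eq_mul] at this
  linarith

theorem exists_abs_apply_le (h1 : 1 ∈ S) (hX : ∀ i, C (r ^ 2) - X i ^ 2 ∈ S)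
    (q : MvPolynomial σ ℝ) : ∃ B : ℝ, 0 ≤ B ∧ ∀ L : MvPolynomial σ ℝ →ₗ[ℝ] ℝ,
      (∀ h ∈ S, ∀ p, 0 ≤ L (h * p ^ 2)) → |L q| ≤ B * L 1 := by
  obtain ⟨B, hB, h⟩ := exists_eventually_abs_apply_le (r := r) ⊤
    (fun L : {L : MvPolynomial σ ℝ →ₗ[ℝ] ℝ // ∀ h ∈ S, ∀ p, 0 ≤ L (h * p ^ 2)} => L.1)
    (fun p => Filter.Eventually.of_forall fun L => apply_sq_nonneg h1 L.2 p)
    (fun i p => Filter.Eventually.of_forall fun L => apply_X_sq_mul_sq_le hX L.2 i p) q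
  rw [Filter.eventually_top] at h
  exact ⟨B, hB, fun L hL => h ⟨L, hL⟩⟩

theorem convex_moduleStates : Convex ℝ (moduleStates S) := by
  rintro _ ⟨L, rfl, hL1, hL⟩ _ ⟨L', rfl, hL1', hL'⟩ a b ha hb hab
  refine ⟨a • L + b • L', by ext; simp, by simp [hL1, hL1', hab], fun h hh p => ?_⟩
  have := hL h hh p
  have := hL' h hh p
  simp only [LinearMap.add_apply, LinearMap.smul_apply, smul_eq_mul]
  positivity

theorem isCompact_moduleStates (h1 : 1 ∈ S) (hX : ∀ i, C (r ^ 2) - X i ^ 2 ∈ S) :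
    IsCompact (moduleStates S) := by
  choose B hB hLB using exists_abs_apply_le h1 hX
  refine (isCompact_univ_pi fun q => isCompact_Icc (a := -B q) (b := B q)).of_isClosed_subset
    ?_ ?_
  · have : moduleStates S
        = Set.range (fun L : MvPolynomial σ ℝ →ₗ[ℝ] ℝ => (L : MvPolynomial σ ℝ → ℝ)) ∩
          ({φ | φ 1 = 1} ∩ ⋂ h ∈ S, ⋂ p : MvPolynomial σ ℝ, {φ | 0 ≤ φ (h * p ^ 2)}) := by
      ext φ
      constructor
      · rintro ⟨L, rfl, hL1, hL⟩
        exact ⟨⟨L, rfl⟩, hL1, by simpa using hL⟩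
      · rintro ⟨⟨L, rfl⟩, hL1, hL⟩
        exact ⟨L, rfl, hL1, by simpa using hL⟩
    rw [this]
    refine (LinearMap.isClosed_range_coe _ _ _).inter
      ((isClosed_eq (continuous_apply _) continuous_const).inter
        (isClosed_biInter fun h _ => isClosed_iInter fun p =>
          isClosed_le continuous_const (continuous_apply _)))
  · rintro _ ⟨L, rfl, hL1, hL⟩ q -
    have := hLB q L hL
    rw [hL1, mul_one, abs_le] at this
    exact this

/-- An extreme functional is multiplicative at `u` if its shifts by `u` and by `c - u` are both
nonnegative on the quadratic module. -/
theorem apply_mul_of_mem_extremePoints (h1 : 1 ∈ S) (hX : ∀ i, C (r ^ 2) - X i ^ 2 ∈ S)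
    {L : MvPolynomial σ ℝ →ₗ[ℝ] ℝ} (hL : (L : _ → ℝ) ∈ (moduleStates S).extremePoints ℝ)
    {u v : MvPolynomial σ ℝ} (c : ℝ) (hc : 0 < c) (huv : u + v = C c)
    (hu : ∀ h ∈ S, ∀ p, 0 ≤ L (u * (h * p ^ 2))) (hv : ∀ h ∈ S, ∀ p, 0 ≤ L (v * (h * p ^ 2)))
    (q : MvPolynomial σ ℝ) : L (u * q) = L u * L q := by
  rw [mem_extremePoints_iff_left] at hL
  obtain ⟨⟨L', hL', hL1, -⟩, hext⟩ := hL
  rw [DFunLike.coe_injective hL'] at hL1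
  clear hL'
  have hzero : ∀ w : MvPolynomial σ ℝ, (∀ h ∈ S, ∀ p, 0 ≤ L (w * (h * p ^ 2))) → L w = 0 →
      ∀ q, L (w * q) = 0 := by
    intro w hw hw0 q
    obtain ⟨B, -, h⟩ := exists_abs_apply_le h1 hX q
    have := h (L.mulShift w) hw
    simpa [hw0] using this
  have hsum : ∀ q, L (u * q) + L (v * q) = c * L q := fun q => by
    rw [← map_add, ← add_mul, huv, ← smul_eq_C_mul, map_smul, smul_eq_mul]
  have hsum1 : L u + L v = c := by simpa [hL1] using hsum 1
  have hu0 : 0 ≤ L u := by simpa using hu 1 h1 1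
  have hv0 : 0 ≤ L v := by simpa using hv 1 h1 1
  rcases hu0.eq_or_lt with hu0 | hu0
  · rw [hzero u hu hu0.symm, ← hu0, zero_mul]
  rcases hv0.eq_or_lt with hv0 | hv0
  · have := hsum q
    rw [hzero v hv hv0.symm] at this
    rw [← hv0] at hsum1
    linear_combination this - L q * hsum1
  have hmem : ∀ w : MvPolynomial σ ℝ, 0 < L w → (∀ h ∈ S, ∀ p, 0 ≤ L (w * (h * p ^ 2))) →
      ((L w)⁻¹ • L.mulShift w : MvPolynomial σ ℝ →ₗ[ℝ] ℝ).toFun ∈ moduleStates S := by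
    intro w hw0 hw
    refine ⟨(L w)⁻¹ • L.mulShift w, rfl, by simp [hw0.ne'], fun h hh p => ?_⟩
    have := hw h hh p
    simp only [LinearMap.smul_apply, LinearMap.mulShift_apply, smul_eq_mul]
    positivity
  have heq := hext _ (hmem u hu0 hu) _ (hmem v hv0 hv)
    ⟨L u / c, L v / c, by positivity, by positivity, by field_simp; exact hsum1, by
      ext q
      have := hsum q
      simp
      field_simp
      linarith⟩
  have := congrFun heq q
  simp at this
  field_simp at this
  exact this

/-- Extreme normalized functionals are evaluations at points where `S` is nonnegative. -/
theorem exists_eval_of_mem_extremePoints (h1 : 1 ∈ S) (hr : 0 < r)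
    (hX : ∀ i, C (r ^ 2) - X i ^ 2 ∈ S)
    {φ : MvPolynomial σ ℝ → ℝ} (hφ : φ ∈ (moduleStates S).extremePoints ℝ) :
    ∃ x : σ → ℝ, (∀ h ∈ S, 0 ≤ eval x h) ∧ ∀ q, φ q = eval x q := by
  obtain ⟨L, rfl, hL1, hL⟩ := hφ.1
  have hpos : ∀ s : MvPolynomial σ ℝ,
      (∀ p, L (s ^ 2 * p ^ 2) ≤ r ^ 2 * L (p ^ 2)) →
      ∀ h ∈ S, ∀ p, 0 ≤ L ((C r + s) * (h * p ^ 2)) := by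
    intro s hs h hh p
    have := L.apply_mul_add_nonneg hr (apply_sq_nonneg h1 hL) (hL h hh) hs p
    rwa [mul_left_comm] at this
  have hmul : ∀ i q, L (X i * q) = L (X i) * L q := by
    intro i q
    have hi := apply_X_sq_mul_sq_le hX hL i
    have := apply_mul_of_mem_extremePoints h1 hX hφ (u := C r + X i) (v := C r + -X i) (2 * r)
      (by positivity) (by simp only [map_mul, map_ofNat]; ring) (hpos _ hi)
      (hpos _ (by simpa using hi)) q
    have e : L (C r) = r := by
      rw [← mul_one (C r), ← smul_eq_C_mul, map_smul, hL1, smul_eq_mul, mul_one]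
    rw [add_mul, map_add, map_add, ← smul_eq_C_mul, map_smul, e, smul_eq_mul] at this
    linarith
  have heval : ∀ q, L q = eval (fun i => L (X i)) q := by
    intro q
    induction q using MvPolynomial.induction_on with
    | C a => rw [← mul_one (C a), ← smul_eq_C_mul, map_smul, hL1]; simp
    | add p q hp hq => rw [map_add, hp, hq, map_add]
    | mul_X p i hp => rw [mul_comm, hmul, hp, map_mul, eval_X]
  exact ⟨_, fun h hh => by rw [← heval]; simpa using hL h hh 1, heval⟩

theorem isCompact_setOf_eval_nonneg (hX : ∀ i, C (r ^ 2) - X i ^ 2 ∈ S) :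
    IsCompact {x : σ → ℝ | ∀ h ∈ S, 0 ≤ eval x h} := by
  refine (isCompact_univ_pi fun _ : σ => isCompact_Icc (a := -|r|) (b := |r|)).of_isClosed_subset
    ?_ ?_
  · simp only [Set.ofPred_forall]
    exact isClosed_biInter fun h _ => isClosed_le continuous_const (continuous_eval h)
  · intro x hx i _
    have := hx _ (hX i)
    simp only [map_sub, map_pow, eval_C, eval_X] at this
    exact abs_le.1 (sq_le_sq.1 (by linarith))

theorem mem_convexHull_of_mem_moduleStates (h1 : 1 ∈ S) (hr : 0 < r)
    (hX : ∀ i, C (r ^ 2) - X i ^ 2 ∈ S) {ι : Type*} [Fintype ι] (F : ι → MvPolynomial σ ℝ)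
    {φ : MvPolynomial σ ℝ → ℝ} (hφ : φ ∈ moduleStates S) :
    (fun i => φ (F i)) ∈
      convexHull ℝ ((fun x i => eval x (F i)) '' {x : σ → ℝ | ∀ h ∈ S, 0 ≤ eval x h}) := by
  set Q := (fun x i => eval x (F i)) '' {x : σ → ℝ | ∀ h ∈ S, 0 ≤ eval x h} with hQ
  have hQc : IsCompact (convexHull ℝ Q) := isCompact_convexHull_of_finiteDimensional
    ((isCompact_setOf_eval_nonneg hX).image (continuous_pi fun i => continuous_eval (F i)))
  let π : (MvPolynomial σ ℝ → ℝ) →ₗ[ℝ] (ι → ℝ) := LinearMap.funLeft ℝ ℝ F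
  have hπ : Continuous π := continuous_pi fun i => continuous_apply (F i)
  have hsub : closure (convexHull ℝ ((moduleStates S).extremePoints ℝ))
      ⊆ π ⁻¹' convexHull ℝ Q := by
    refine closure_minimal (convexHull_min ?_ ?_) (hQc.isClosed.preimage hπ)
    · intro ψ hψ
      obtain ⟨x, hx, h⟩ := exists_eval_of_mem_extremePoints h1 hr hX hψ
      exact subset_convexHull ℝ Q ⟨x, hx, by ext i; exact (h (F i)).symm⟩
    · exact (convex_convexHull ℝ Q).linear_preimage π
  rw [closure_convexHull_extremePoints (isCompact_moduleStates h1 hX) convex_moduleStates] at hsub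
  exact hsub hφ

/-- A functional that is nonnegative on an Archimedean quadratic module agrees, at finitely many
polynomials, with integration against a finitely supported measure. -/
theorem exists_measure_of_nonneg_quadraticModule (h1 : 1 ∈ S) (hr : 0 < r)
    (hX : ∀ i, C (r ^ 2) - X i ^ 2 ∈ S) [Finite σ] {ι : Type*} [Fintype ι]
    (F : ι → MvPolynomial σ ℝ)
    (L : MvPolynomial σ ℝ →ₗ[ℝ] ℝ) (hL : ∀ h ∈ S, ∀ p, 0 ≤ L (h * p ^ 2)) :
    ∃ μ : Measure (σ → ℝ), IsFiniteMeasure μ ∧ μ {x | ∀ h ∈ S, 0 ≤ eval x h}ᶜ = 0 ∧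
      (∀ q : MvPolynomial σ ℝ, Integrable (fun x => eval x q) μ) ∧
      (∀ i, ∫ x, eval x (F i) ∂μ = L (F i)) ∧ μ.real Set.univ = L 1 := by
  have hL1 : 0 ≤ L 1 := by simpa using hL 1 h1 1
  rcases hL1.eq_or_lt with hL1 | hL1
  · have : ∀ q, L q = 0 := by
      intro q
      obtain ⟨B, -, h⟩ := exists_abs_apply_le h1 hX q
      simpa [← hL1] using h L hL
    exact ⟨0, inferInstance, by simp, by simp, by simp [this], by simp [this]⟩
  have hmem : (((L 1)⁻¹ • L : MvPolynomial σ ℝ →ₗ[ℝ] ℝ) : _ → ℝ) ∈ moduleStates S := by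
    refine ⟨_, rfl, by simp [hL1.ne'], fun h hh p => ?_⟩
    have := hL h hh p
    simp only [LinearMap.smul_apply, smul_eq_mul]
    positivity
  have key := mem_convexHull_of_mem_moduleStates h1 hr hX F hmem
  rw [convexHull_eq] at key
  obtain ⟨κ, t, w, z, hw, hw1, hz, he⟩ := key
  choose! x hx hxz using hz
  rw [Finset.centerMass_eq_of_sum_1 _ _ hw1] at he
  let μ : Measure (σ → ℝ) := ∑ k ∈ t, ENNReal.ofReal (L 1 * w k) • Measure.dirac (x k)
  have hint : ∀ k ∈ t, ∀ q : MvPolynomial σ ℝ, Integrable (fun y => eval y q)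
      (ENNReal.ofReal (L 1 * w k) • Measure.dirac (x k)) := fun k _ q =>
    (integrable_dirac (by simp)).smul_measure ENNReal.ofReal_ne_top
  have hval : ∀ q : MvPolynomial σ ℝ, ∫ y, eval y q ∂μ = L 1 * ∑ k ∈ t, w k * eval (x k) q := by
    intro q
    rw [integral_finsetSum_measure fun k hk => hint k hk q, Finset.mul_sum]
    refine Finset.sum_congr rfl fun k hk => ?_
    rw [integral_smul_measure, integral_dirac, smul_eq_mul,
      ENNReal.toReal_ofReal (mul_nonneg hL1.le (hw k hk)), mul_assoc]
  have hfin : IsFiniteMeasure μ := by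
    constructor
    simp [μ, ENNReal.sum_lt_top]
  refine ⟨μ, hfin, ?_, fun q => integrable_finsetSum_measure.2 fun k hk => hint k hk q,
    fun i => ?_, ?_⟩
  · have hc : MeasurableSet {x : σ → ℝ | ∀ h ∈ S, 0 ≤ eval x h}ᶜ :=
      (isCompact_setOf_eval_nonneg hX).measurableSet.compl
    simp only [μ, Measure.coe_finsetSum, Finset.sum_apply, Finset.sum_eq_zero_iff]
    intro k hk
    simpa [Measure.dirac_apply' _ hc] using Or.inr (hx k hk)
  · rw [hval]
    have := congrFun he i
    simp only [Finset.sum_apply, Pi.smul_apply, smul_eq_mul, LinearMap.smul_apply] at this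
    rw [eq_inv_mul_iff_mul_eq₀ hL1.ne'] at this
    rw [← this]
    congr 1
    exact Finset.sum_congr rfl fun k hk => by rw [← hxz k hk]
  · simpa [hw1] using hval 1

end

theorem eval_restrictVars {n : ℕ} {U : Finset (Fin n)} {x : Fin n → ℝ} (hx : ∀ i ∉ U, x i = 0)
    (q : MvPolynomial (Fin n) ℝ) : eval x (restrictVars U q) = eval x q := by
  induction q using MvPolynomial.induction_on with
  | C a => simp [restrictVars]
  | add p q hp hq => simp [hp, hq]
  | mul_X p i hp =>
    rw [map_mul, map_mul, hp, map_mul]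
    congr 1
    by_cases hi : i ∈ U <;> simp [restrictVars, hi, hx]

theorem restrictVars_restrictVars {n : ℕ} (U : Finset (Fin n)) (q : MvPolynomial (Fin n) ℝ) :
    restrictVars U (restrictVars U q) = restrictVars U q := by
  induction q using MvPolynomial.induction_on with
  | C a => simp [restrictVars]
  | add p q hp hq => simp [hp, hq]
  | mul_X p i hp =>
    rw [map_mul, map_mul, hp]
    congr 1
    by_cases hi : i ∈ U <;> simp [restrictVars, hi]

theorem IsSumSq.map_ringHom {A B : Type*} [CommSemiring A] [CommSemiring B] (φ : A →+* B) {s : A}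
    (hs : IsSumSq s) : IsSumSq (φ s) := by
  induction hs with
  | zero => simp
  | sq_add a _ ih => rw [map_add, map_mul]; exact .sq_add _ ih

theorem eval_nonneg_of_inTruncModuleRes {n m : ℕ} {U : Finset (Fin n)}
    {g : Fin m → MvPolynomial (Fin n) ℝ} {t : ℕ} {q : MvPolynomial (Fin n) ℝ}
    (hq : inTruncModuleRes U g t q) {x : Fin n → ℝ} (hx : ∀ i ∉ U, x i = 0)
    (hg : ∀ j, 0 ≤ eval x (g j)) : 0 ≤ eval x q := by
  obtain ⟨σ, hσ, -, rfl⟩ := hq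
  rw [map_sum]
  refine Finset.sum_nonneg fun j _ => ?_
  rw [map_mul, eval_restrictVars hx]
  refine mul_nonneg ((hσ j).1.map_ringHom (eval x)).nonneg ?_
  refine Fin.cases ?_ (fun j => ?_) j
  · simp
  · simpa using hg j

theorem inTruncModuleRes.mono {n m : ℕ} {U : Finset (Fin n)}
    {g : Fin m → MvPolynomial (Fin n) ℝ} {s t : ℕ} (hst : s ≤ t) {q : MvPolynomial (Fin n) ℝ}
    (hq : inTruncModuleRes U g s q) : inTruncModuleRes U g t q := by
  obtain ⟨σ, hσ, hdeg, rfl⟩ := hq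
  exact ⟨σ, hσ, fun j => (hdeg j).trans (by omega), rfl⟩

/-- The restriction of an element of the quadratic module lies in all late truncations. -/
theorem eventually_inTruncModuleRes {n m : ℕ} (U : Finset (Fin n))
    (g : Fin m → MvPolynomial (Fin n) ℝ) {σ : Fin (m + 1) → MvPolynomial (Fin n) ℝ}
    (hσ : ∀ j, IsSumSq (σ j)) :
    ∀ᶠ t in Filter.atTop, inTruncModuleRes U g t (restrictVars U
      (∑ j, σ j * (Fin.cons 1 g : Fin (m + 1) → MvPolynomial (Fin n) ℝ) j)) := by
  have : ∀ᶠ t : ℕ in Filter.atTop, ∀ j, (restrictVars U (σ j) * restrictVars U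
      ((Fin.cons 1 g : Fin (m + 1) → MvPolynomial (Fin n) ℝ) j)).totalDegree ≤ 2 * t :=
    Filter.eventually_all.2 fun j => by
      filter_upwards [Filter.eventually_ge_atTop (restrictVars U (σ j) * restrictVars U
        ((Fin.cons 1 g : Fin (m + 1) → MvPolynomial (Fin n) ℝ) j)).totalDegree] with t ht
      omega
  filter_upwards [this] with t ht
  exact ⟨fun j => restrictVars U (σ j),
    fun j => ⟨(hσ j).map_ringHom (restrictVars U).toRingHom, restrictVars_restrictVars U _⟩, ht,
    by simp [map_sum]⟩

/-- Splitting a measure along the coordinate subspaces `{x | Supp x ⊆ V k}`: integration over the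
pieces gives functionals feasible for every truncation. -/
theorem exists_functionals_of_measure {n m p : ℕ} (g : Fin m → MvPolynomial (Fin n) ℝ)
    (V : Fin p → Finset (Fin n)) (μ : Measure (Fin n → ℝ))
    (hg : ∀ᵐ x ∂μ, ∀ j, 0 ≤ eval x (g j)) (hV : ∀ᵐ x ∂μ, ∃ k, ∀ i ∉ V k, x i = 0)
    (hint : ∀ q : MvPolynomial (Fin n) ℝ, Integrable (fun x => eval x q) μ) :
    ∃ L : Fin p → (MvPolynomial (Fin n) ℝ →ₗ[ℝ] ℝ),
      (∀ q, ∑ k, L k (restrictVars (V k) q) = ∫ x, eval x q ∂μ) ∧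
      ∀ t k q, inTruncModuleRes (V k) g t q → 0 ≤ L k q := by
  let D : Fin p → Set (Fin n → ℝ) := fun k => {x | ∀ i ∉ V k, x i = 0}
  have hD : ∀ k, MeasurableSet (D k) := fun k => by
    simp only [D, Set.ofPred_forall]
    exact MeasurableSet.iInter fun i => MeasurableSet.iInter fun _ =>
      measurableSet_eq_fun (measurable_pi_apply i) measurable_const
  let A : Fin p → Set (Fin n → ℝ) := fun k => D k \ ⋃ j, ⋃ (_ : j < k), D j
  have hA : ∀ k, MeasurableSet (A k) := fun k =>
    (hD k).diff (MeasurableSet.iUnion fun j => MeasurableSet.iUnion fun _ => hD j)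
  have hdisj : Pairwise (Function.onFun Disjoint A) := by
    refine (pairwise_disjoint_on A).2 fun j k hjk => Set.disjoint_left.2 fun x hx hx' => hx'.2 ?_
    exact Set.mem_iUnion₂.2 ⟨j, hjk, hx.1⟩
  have hcov : ∀ᵐ x ∂μ, x ∈ ⋃ k, A k := by
    filter_upwards [hV] with x hx
    obtain ⟨k, hk, hmin⟩ := wellFounded_lt.has_min {k | x ∈ D k} hx
    refine Set.mem_iUnion.2 ⟨k, hk, fun h => ?_⟩
    obtain ⟨j, hj, hxj⟩ := Set.mem_iUnion₂.1 h
    exact hmin j hxj hj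
  refine ⟨fun k =>
    { toFun := fun q => ∫ x in A k, eval x q ∂μ
      map_add' := fun q q' => by
        simp only [map_add]
        exact integral_add (hint q).integrableOn (hint q').integrableOn
      map_smul' := fun c q => by
        simp only [smul_eval, RingHom.id_apply, smul_eq_mul]
        exact integral_const_mul _ _ }, fun q => ?_, fun t k q hq => ?_⟩
  · calc ∑ k, ∫ x in A k, eval x (restrictVars (V k) q) ∂μ = ∑ k, ∫ x in A k, eval x q ∂μ :=
          Finset.sum_congr rfl fun k _ => setIntegral_congr_fun (hA k) fun x hx =>
            eval_restrictVars hx.1 q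
      _ = ∫ x in ⋃ k, A k, eval x q ∂μ :=
          (integral_iUnion_fintype hA hdisj fun k => (hint q).integrableOn).symm
      _ = _ := by rw [Measure.restrict_eq_self_of_ae_mem hcov]
  · refine setIntegral_nonneg_of_ae_restrict ?_
    filter_upwards [ae_restrict_of_ae hg, ae_restrict_mem (hA k)] with x hx hxA
    exact eval_nonneg_of_inTruncModuleRes hq hxA.1 hx

/-- A pointwise bounded family of linear functionals has a pointwise limit along an
ultrafilter. -/
theorem exists_linearMap_tendsto_of_eventually_bounded {E T : Type*} [AddCommGroup E] [Module ℝ E]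
    (l : Ultrafilter T) (L : T → E →ₗ[ℝ] ℝ) (hL : ∀ q, ∃ B : ℝ, ∀ᶠ t in l, |L t q| ≤ B) :
    ∃ M : E →ₗ[ℝ] ℝ, ∀ q, Filter.Tendsto (fun t => L t q) l (nhds (M q)) := by
  have : ∀ q, ∃ y, Filter.Tendsto (fun t => L t q) l (nhds y) := by
    intro q
    obtain ⟨B, hB⟩ := hL q
    obtain ⟨y, -, hy⟩ := (isCompact_Icc (a := -B) (b := B)).ultrafilter_le_nhds
      (l.map fun t => L t q) (by
        rw [Filter.le_principal_iff, Ultrafilter.mem_coe, Ultrafilter.mem_map]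
        filter_upwards [hB] with t ht using abs_le.1 ht)
    exact ⟨y, hy⟩
  choose M hM using this
  refine ⟨{ toFun := M, map_add' := fun q q' => ?_, map_smul' := fun c q => ?_ }, hM⟩
  · refine tendsto_nhds_unique (hM (q + q')) ?_
    simpa using (hM q).add (hM q')
  · refine tendsto_nhds_unique (hM (c • q)) ?_
    simpa using (hM q).const_mul c

/-- If the GMP is feasible, a Slater-type condition holds, and the quadratic
module `M(g)` is Archimedean (`R − Σᵢ xᵢ² ∈ M(g)` for some `R > 0`), then the ideal-sparse
moment bounds converge: `lim_{t→∞} ξ^isp_t = val`. -/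
theorem ideal_sparse_bounds_converge
    (n m N p : ℕ) (G : SimpleGraph (Fin n))
    (g : Fin m → MvPolynomial (Fin n) ℝ)
    (f0 : MvPolynomial (Fin n) ℝ) (f : Fin N → MvPolynomial (Fin n) ℝ) (a : Fin N → ℝ)
    (K : Set (Fin n → ℝ))
    (hK : K = {x | (∀ j, 0 ≤ eval x (g j)) ∧
      ∀ i j : Fin n, i ≠ j → ¬ G.Adj i j → x i * x j = 0})
    (V : Fin p → Finset (Fin n))
    (hmax : ∀ k, G.IsClique (V k : Set (Fin n)) ∧
      ∀ S : Finset (Fin n), G.IsClique (S : Set (Fin n)) → V k ⊆ S → S = V k)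
    (hall : ∀ S : Finset (Fin n),
      (G.IsClique (S : Set (Fin n)) ∧
        ∀ S' : Finset (Fin n), G.IsClique (S' : Set (Fin n)) → S ⊆ S' → S' = S) →
      ∃ k, V k = S)
    -- feasibility of the GMP
    (hfeas : ∃ μ : Measure (Fin n → ℝ), IsFiniteMeasure μ ∧ μ Kᶜ = 0 ∧
      (∀ q : MvPolynomial (Fin n) ℝ, Integrable (fun x => eval x q) μ) ∧
      (∀ i, ∫ x, eval x (f i) ∂μ = a i))
    -- Slater-type condition
    (hSlater : ∃ (z0 : ℝ) (z : Fin N → ℝ), ∀ x ∈ K,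
      0 < z0 * eval x f0 + ∑ i, z i * eval x (f i))
    -- Archimedean condition: `R − Σ xᵢ² ∈ M(g)`
    (hArch : ∃ R : ℝ, 0 < R ∧ ∃ σ : Fin (m + 1) → MvPolynomial (Fin n) ℝ,
      (∀ j, IsSumSq (σ j)) ∧
      (C R - ∑ i, X i ^ 2 : MvPolynomial (Fin n) ℝ)
        = ∑ j, σ j * (Fin.cons 1 g : Fin (m + 1) → MvPolynomial (Fin n) ℝ) j)
    (val : EReal)
    (hval : val = sInf {v : EReal | ∃ μ : Measure (Fin n → ℝ), IsFiniteMeasure μ ∧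
      μ Kᶜ = 0 ∧
      (∀ q : MvPolynomial (Fin n) ℝ, Integrable (fun x => eval x q) μ) ∧
      (∀ i, ∫ x, eval x (f i) ∂μ = a i) ∧
      v = ((∫ x, eval x f0 ∂μ : ℝ) : EReal)})
    (xisp : ℕ → EReal)
    (hxisp : ∀ t : ℕ, xisp t =
      sInf {v : EReal | ∃ L : Fin p → (MvPolynomial (Fin n) ℝ →ₗ[ℝ] ℝ),
        (∀ i, ∑ k, L k (restrictVars (V k) (f i)) = a i) ∧
        (∀ k q, inTruncModuleRes (V k) g t q → 0 ≤ L k q) ∧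
        v = ((∑ k, L k (restrictVars (V k) f0) : ℝ) : EReal)}) :
    Filter.Tendsto xisp Filter.atTop (nhds val) := by
  classical
  have hKμ : ∀ {μ : Measure (Fin n → ℝ)}, μ Kᶜ = 0 → ∀ᵐ x ∂μ, x ∈ K := fun h => h
  -- every truncated bound is below the value
  have hle : ∀ t, xisp t ≤ val := by
    intro t
    rw [hxisp, hval]
    refine le_sInf ?_
    rintro _ ⟨μ, _, hμK, hμint, hμf, rfl⟩
    obtain ⟨L, hLint, hLpos⟩ := exists_functionals_of_measure g V μ
      ((hKμ hμK).mono fun x hx => by rw [hK] at hx; exact hx.1)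
      ((hKμ hμK).mono fun x hx => by
        rw [hK] at hx
        obtain ⟨S, hS, hSmax⟩ := (Set.toFinite {S : Finset (Fin n) |
          G.IsClique (S : Set (Fin n))}).exists_le_maximal
          (a := Finset.univ.filter fun i => x i ≠ 0) (by
            intro i hi j hj hij
            by_contra hadj
            have := hx.2 i j hij hadj
            simp at hi hj
            simp [hi, hj] at this)
        obtain ⟨k, rfl⟩ := hall S ⟨hSmax.1, fun S' hS' h => (hSmax.eq_of_le hS' h).symm⟩
        refine ⟨k, fun i hi => ?_⟩
        by_contra hxi
        exact hi (hS (by simpa using hxi)))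
      hμint
    refine sInf_le ⟨L, fun i => by rw [hLint, hμf], hLpos t, by rw [hLint]⟩
  have hmono : Monotone xisp := by
    intro s t hst
    rw [hxisp, hxisp]
    refine sInf_le_sInf ?_
    rintro v ⟨L, h1, h2, h3⟩
    exact ⟨L, h1, fun k q hq => h2 k q (hq.mono hst), h3⟩
  suffices h : ⨆ t, xisp t = val by
    rw [← h]; exact tendsto_atTop_iSup hmono
  refine le_antisymm (iSup_le hle) ?_
  by_contra! hlt
  obtain ⟨c, hc, hcval⟩ := EReal.lt_iff_exists_real_btwn.1 hlt
  have hex : ∀ t, ∃ L : Fin p → (MvPolynomial (Fin n) ℝ →ₗ[ℝ] ℝ),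
      (∀ i, ∑ k, L k (restrictVars (V k) (f i)) = a i) ∧
      (∀ k q, inTruncModuleRes (V k) g t q → 0 ≤ L k q) ∧
      ∑ k, L k (restrictVars (V k) f0) ≤ c := by
    intro t
    have h := (le_iSup xisp t).trans_lt hc
    rw [hxisp, sInf_lt_iff] at h
    obtain ⟨_, ⟨L, h1, h2, rfl⟩, h⟩ := h
    exact ⟨L, h1, h2, (EReal.coe_lt_coe_iff.1 h).le⟩
  choose L hLf hLpos hLc using hex
  let Λ : ℕ → MvPolynomial (Fin n) ℝ →ₗ[ℝ] ℝ := fun t =>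
    ∑ k, L t k ∘ₗ (restrictVars (V k)).toLinearMap
  have hΛ : ∀ t q, Λ t q = ∑ k, L t k (restrictVars (V k) q) := fun t q => by
    simp [Λ, LinearMap.sum_apply]
  have hΛmod : ∀ σ : Fin (m + 1) → MvPolynomial (Fin n) ℝ, (∀ j, IsSumSq (σ j)) →
      ∀ᶠ t in Filter.atTop, 0 ≤ Λ t (∑ j, σ j *
        (Fin.cons 1 g : Fin (m + 1) → MvPolynomial (Fin n) ℝ) j) := by
    intro σ hσ
    filter_upwards [Filter.eventually_all.2 fun k => eventually_inTruncModuleRes (V k) g hσ]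
      with t ht
    rw [hΛ]
    exact Finset.sum_nonneg fun k _ => hLpos t k _ (ht k)
  have hΛgen : ∀ j q, ∀ᶠ t in Filter.atTop, 0 ≤ Λ t
      ((Fin.cons 1 g : Fin (m + 1) → MvPolynomial (Fin n) ℝ) j * q ^ 2) := by
    intro j q
    have := hΛmod (Pi.single j (q * q)) fun i => by
      by_cases h : i = j
      · subst h; simp
      · simp [h]
    simpa [Pi.single_apply, ite_mul, mul_comm, ← pow_two] using this
  have hΛsq : ∀ q, ∀ᶠ t in Filter.atTop, 0 ≤ Λ t (q ^ 2) := fun q => by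
    simpa using hΛgen 0 q
  obtain ⟨R, hR, σ, hσ, hRσ⟩ := hArch
  have hΛball : ∀ i q, ∀ᶠ t in Filter.atTop, 0 ≤ Λ t ((C (√R ^ 2) - X i ^ 2) * q ^ 2) := by
    intro i q
    have h1 := hΛmod (fun j => σ j * (q * q)) fun j => (hσ j).mul (.mul_self q)
    have h2 : ∀ᶠ t in Filter.atTop, ∀ j, 0 ≤ Λ t ((X j * q) ^ 2) :=
      Filter.eventually_all.2 fun j => hΛsq _
    filter_upwards [h1, h2] with t h1 h2
    have e : (C (√R ^ 2) - X i ^ 2) * q ^ 2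
        = ∑ j, σ j * (q * q) * (Fin.cons 1 g : Fin (m + 1) → MvPolynomial (Fin n) ℝ) j
          + ∑ j ∈ Finset.univ.erase i, (X j * q) ^ 2 := by
      have e1 : ∑ j, σ j * (q * q) * (Fin.cons 1 g : Fin (m + 1) → MvPolynomial (Fin n) ℝ) j
          = (C R - ∑ j, X j ^ 2) * q ^ 2 := by
        rw [hRσ, Finset.sum_mul]
        exact Finset.sum_congr rfl fun j _ => by ring
      rw [e1, Real.sq_sqrt hR.le, ← Finset.add_sum_erase _ _ (Finset.mem_univ i)]
      simp only [mul_pow, ← Finset.sum_mul]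
      ring
    rw [e, map_add, map_sum (Λ t) _ (Finset.univ.erase i)]
    exact add_nonneg h1 (Finset.sum_nonneg fun j _ => h2 j)
  have hΛedge : ∀ i j, i ≠ j → ¬ G.Adj i j → ∀ q t, Λ t (X i * X j * q) = 0 := by
    intro i j hij hadj q t
    rw [hΛ]
    refine Finset.sum_eq_zero fun k _ => ?_
    have : restrictVars (V k) (X i * X j : MvPolynomial (Fin n) ℝ) = 0 := by
      by_cases hi : i ∈ V k
      · have hj : j ∉ V k := fun hj => hadj ((hmax k).1 hi hj hij)
        simp [restrictVars, hj]
      · simp [restrictVars, hi]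
    rw [map_mul, this, zero_mul, map_zero]
  -- the generators of an Archimedean quadratic module with nonnegativity set inside `K`
  let S : Set (MvPolynomial (Fin n) ℝ) :=
    Set.range (Fin.cons 1 g : Fin (m + 1) → MvPolynomial (Fin n) ℝ)
      ∪ Set.range (fun i => C (√R ^ 2) - X i ^ 2)
      ∪ {h | ∃ i j, i ≠ j ∧ ¬ G.Adj i j ∧ (h = X i * X j ∨ h = -(X i * X j))}
  have h1S : (1 : MvPolynomial (Fin n) ℝ) ∈ S := .inl (.inl ⟨0, by simp⟩)
  have hXS : ∀ i, C (√R ^ 2) - X i ^ 2 ∈ S := fun i => .inl (.inr ⟨i, rfl⟩)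
  have hSK : {x : Fin n → ℝ | ∀ h ∈ S, 0 ≤ eval x h} ⊆ K := by
    intro x hx
    rw [hK]
    refine ⟨fun j => by simpa using hx _ (.inl (.inl ⟨j.succ, rfl⟩)), fun i j hij hadj => ?_⟩
    have h1 := hx _ (.inr ⟨i, j, hij, hadj, .inl rfl⟩)
    have h2 := hx _ (.inr ⟨i, j, hij, hadj, .inr rfl⟩)
    simp only [map_neg, map_mul, eval_X] at h1 h2
    linarith
  have hΛS : ∀ h ∈ S, ∀ q, ∀ᶠ t in Filter.atTop, 0 ≤ Λ t (h * q ^ 2) := by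
    rintro h ((⟨j, rfl⟩ | ⟨i, rfl⟩) | ⟨i, j, hij, hadj, rfl | rfl⟩) q
    · exact hΛgen j q
    · exact hΛball i q
    · exact Filter.Eventually.of_forall fun t => (hΛedge i j hij hadj _ t).ge
    · exact Filter.Eventually.of_forall fun t => by
        rw [neg_mul, map_neg, hΛedge i j hij hadj, neg_zero]
  -- normalise, and pass to the limit along an ultrafilter
  let U : Ultrafilter ℕ := Ultrafilter.of Filter.atTop
  have hU : (U : Filter ℕ) ≤ Filter.atTop := Ultrafilter.of_le _
  have hmass : ∀ᶠ t in U, 0 ≤ Λ t 1 := hU (by simpa using hΛsq 1)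
  let d : ℕ → ℝ := fun t => (1 + Λ t 1)⁻¹
  have hd : ∀ᶠ t in U, 0 < d t ∧ d t ≤ 1 ∧ d t + d t * Λ t 1 = 1 := by
    filter_upwards [hmass] with t ht
    have : 0 < 1 + Λ t 1 := by linarith
    refine ⟨inv_pos.2 this, inv_le_one_of_one_le₀ (by linarith), ?_⟩
    simp only [d]
    field_simp
  obtain ⟨M, hM⟩ := exists_linearMap_tendsto_of_eventually_bounded U (fun t => d t • Λ t) (by
    intro q
    obtain ⟨B, hB, h⟩ := exists_eventually_abs_apply_le (r := √R) Filter.atTop Λ hΛsq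
      (fun i p => (hΛball i p).mono fun t ht => by
        rw [sub_mul, map_sub, ← smul_eq_C_mul, map_smul, smul_eq_mul] at ht
        linarith) q
    refine ⟨B, ?_⟩
    filter_upwards [hU h, hd] with t h ⟨hd0, hd1, hd2⟩
    rw [LinearMap.smul_apply, smul_eq_mul, abs_mul, abs_of_pos hd0]
    calc d t * |Λ t q| ≤ d t * (B * Λ t 1) := by gcongr
      _ = B * (d t * Λ t 1) := by ring
      _ ≤ B * 1 := by gcongr; linarith
      _ = B := mul_one B)
  simp only [LinearMap.smul_apply, smul_eq_mul] at hM
  set θ := 1 - M 1 with hθ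
  have hdθ : Filter.Tendsto d U (nhds θ) := by
    refine ((hM 1).const_sub 1).congr' ?_
    filter_upwards [hd] with t ⟨_, _, h⟩
    linarith
  have hθ0 : 0 ≤ θ := ge_of_tendsto hdθ (hd.mono fun t h => h.1.le)
  have hMS : ∀ h ∈ S, ∀ q, 0 ≤ M (h * q ^ 2) := fun h hh q =>
    ge_of_tendsto (hM _) (by
      filter_upwards [hU (hΛS h hh q), hd] with t ht hd
      exact mul_nonneg hd.1.le ht)
  have hMf : ∀ i, M (f i) = θ * a i := fun i =>
    tendsto_nhds_unique (hM (f i)) (by simpa only [hΛ, hLf] using hdθ.mul_const (a i))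
  have hMf0 : M f0 ≤ θ * c := le_of_tendsto_of_tendsto (hM f0) (hdθ.mul_const c) (by
    filter_upwards [hd] with t hd
    rw [hΛ]
    exact mul_le_mul_of_nonneg_left (hLc t) hd.1.le)
  obtain ⟨ν, hνfin, hνS, hνint, hνF, hν1⟩ := exists_measure_of_nonneg_quadraticModule h1S
    (Real.sqrt_pos.2 hR) hXS (fun i : Option (Fin N) => i.elim f0 f) M hMS
  have hνK : ν Kᶜ = 0 := measure_mono_null (Set.compl_subset_compl.2 hSK) hνS
  have hνf : ∀ i, ∫ x, eval x (f i) ∂ν = θ * a i := fun i => (hνF (some i)).trans (hMf i)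
  have hνf0 : ∫ x, eval x f0 ∂ν ≤ θ * c := (hνF none).trans_le hMf0
  -- a feasible measure with small objective contradicts the choice of `c`
  have hcontra : ∀ μ : Measure (Fin n → ℝ), IsFiniteMeasure μ → μ Kᶜ = 0 →
      (∀ q : MvPolynomial (Fin n) ℝ, Integrable (fun x => eval x q) μ) →
      (∀ i, ∫ x, eval x (f i) ∂μ = a i) → c < ∫ x, eval x f0 ∂μ := by
    intro μ h1 h2 h3 h4
    rw [← EReal.coe_lt_coe_iff]
    refine hcval.trans_le ?_
    rw [hval]
    exact sInf_le ⟨μ, h1, h2, h3, h4, rfl⟩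
  have hscale : ∀ s : ℝ, 0 ≤ s → ∀ q : MvPolynomial (Fin n) ℝ,
      ∫ x, eval x q ∂(ENNReal.ofReal s • ν) = s * ∫ x, eval x q ∂ν := by
    intro s hs q
    rw [integral_smul_measure, ENNReal.toReal_ofReal hs, smul_eq_mul]
  have hsfin : ∀ s : ℝ, IsFiniteMeasure (ENNReal.ofReal s • ν) := fun s =>
    ν.smul_finite ENNReal.ofReal_ne_top
  rcases hθ0.eq_or_lt with hθ0 | hθ0
  · -- mass escapes to infinity: there is a recession direction of negative objective
    rw [← hθ0, zero_mul] at hνf0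
    simp only [← hθ0, zero_mul] at hνf
    have hν0 : ν.real Set.univ = 1 := by rw [hν1]; linarith
    have hneg : ∫ x, eval x f0 ∂ν < 0 := by
      refine lt_of_le_of_ne hνf0 fun h0 => ?_
      obtain ⟨z0, z, hz⟩ := hSlater
      have hi : Integrable (fun x => z0 * eval x f0 + ∑ i, z i * eval x (f i)) ν :=
        ((hνint f0).const_mul z0).add
          (integrable_finsetSum _ fun i _ => (hνint (f i)).const_mul (z i))
      have hz0 : ∫ x, (z0 * eval x f0 + ∑ i, z i * eval x (f i)) ∂ν = 0 := by
        rw [integral_add ((hνint f0).const_mul z0)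
          (integrable_finsetSum _ fun i _ => (hνint (f i)).const_mul (z i)),
          integral_finsetSum _ fun i _ => (hνint (f i)).const_mul (z i)]
        simp [integral_const_mul, h0, hνf]
      rw [integral_eq_zero_iff_of_nonneg_ae ((hKμ hνK).mono fun x hx => (hz x hx).le) hi] at hz0
      have : ∀ᵐ x ∂ν, False := by
        filter_upwards [hz0, hKμ hνK] with x h hx
        exact (hz x hx).ne' h
      rw [Filter.eventually_false_iff_eq_bot, ae_eq_bot] at this
      simp [this] at hν0
    obtain ⟨μ, hμfin, hμK, hμint, hμf⟩ := hfeas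
    set v := ∫ x, eval x f0 ∂ν with hv
    have hτ : 0 ≤ max 0 ((∫ x, eval x f0 ∂μ - c) / -v) := le_max_left _ _
    set τ := max 0 ((∫ x, eval x f0 ∂μ - c) / -v) with hτdef
    have hτint : ∀ q : MvPolynomial (Fin n) ℝ,
        Integrable (fun x => eval x q) (ENNReal.ofReal τ • ν) :=
      fun q => (hνint q).smul_measure ENNReal.ofReal_ne_top
    have := hsfin τ
    have := hcontra (μ + ENNReal.ofReal τ • ν) inferInstance (by simp [hμK, hνK])
      (fun q => (hμint q).add_measure (hτint q))
      (fun i => by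
        rw [integral_add_measure (hμint _) (hτint _), hμf, hscale τ hτ, hνf, mul_zero, add_zero])
    rw [integral_add_measure (hμint _) (hτint _), hscale τ hτ] at this
    have h2 : (∫ x, eval x f0 ∂μ - c) / -v ≤ τ := le_max_right _ _
    rw [div_le_iff₀ (by linarith)] at h2
    linarith
  · have hθi : 0 ≤ θ⁻¹ := (inv_pos.2 hθ0).le
    have := hcontra (ENNReal.ofReal θ⁻¹ • ν) (hsfin _) (by simp [hνK])
      (fun q => (hνint q).smul_measure ENNReal.ofReal_ne_top)
      (fun i => by rw [hscale _ hθi, hνf, inv_mul_cancel_left₀ hθ0.ne'])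
    rw [hscale _ hθi, inv_mul_eq_div, lt_div_iff₀ hθ0, mul_comm] at this
    linarith
end

section
/- Let m ≥ 1 and A = [[(m+1)I_m, J_m],[J_m, (m+1)I_m]] ∈ S^{2m}. Then the (2m+1)×(2m+1) matrix [[2m(m+1)/(2m+1), √(m+1)·𝟙ᵀ],[√(m+1)·𝟙, A]] is positive semidefinite, where 𝟙 ∈ ℝ^{2m} is the all-ones vector; equivalently, (2m(m+1)/(2m+1))·A − (m+1)·J_{2m} is positive semidefinite. -/
open Matrix

/-- For `A = [[(m+1)Iₘ, Jₘ],[Jₘ, (m+1)Iₘ]]`, the quadratic form of `A` dominates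
`(2m+1)/(2m)` times the square of the coordinate sum. -/
lemma sq_sum_le_dotProduct_fromBlocks_mulVec (m : ℕ) (v : Fin m ⊕ Fin m → ℝ) :
    (2 * (m : ℝ) + 1) * (∑ i, v i) ^ 2 ≤ 2 * (m : ℝ) *
      (v ⬝ᵥ (fromBlocks (((m : ℝ) + 1) • (1 : Matrix (Fin m) (Fin m) ℝ)) (of fun _ _ => 1)
        (of fun _ _ => 1) (((m : ℝ) + 1) • (1 : Matrix (Fin m) (Fin m) ℝ)) *ᵥ v)) := by
  have form : v ⬝ᵥ (fromBlocks (((m : ℝ) + 1) • (1 : Matrix (Fin m) (Fin m) ℝ)) (of fun _ _ => 1)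
        (of fun _ _ => 1) (((m : ℝ) + 1) • (1 : Matrix (Fin m) (Fin m) ℝ)) *ᵥ v) =
      ((m : ℝ) + 1) * (∑ i, v (.inl i) ^ 2 + ∑ i, v (.inr i) ^ 2) +
        2 * (∑ i, v (.inl i)) * ∑ i, v (.inr i) := by
    have top (i : Fin m) : (fromBlocks (((m : ℝ) + 1) • (1 : Matrix (Fin m) (Fin m) ℝ))
        (of fun _ _ => 1) (of fun _ _ => 1) (((m : ℝ) + 1) • (1 : Matrix (Fin m) (Fin m) ℝ)) *ᵥ v)
        (.inl i) = ((m : ℝ) + 1) * v (.inl i) + ∑ j, v (.inr j) := by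
      simp [mulVec, dotProduct, Matrix.one_apply]
    have bottom (i : Fin m) : (fromBlocks (((m : ℝ) + 1) • (1 : Matrix (Fin m) (Fin m) ℝ))
        (of fun _ _ => 1) (of fun _ _ => 1) (((m : ℝ) + 1) • (1 : Matrix (Fin m) (Fin m) ℝ)) *ᵥ v)
        (.inr i) = ∑ j, v (.inl j) + ((m : ℝ) + 1) * v (.inr i) := by
      simp [mulVec, dotProduct, Matrix.one_apply]
    simp only [dotProduct, Fintype.sum_sum_type, top, bottom, mul_add, Finset.sum_add_distrib,
      ← Finset.sum_mul, ← Finset.mul_sum, mul_left_comm _ ((m : ℝ) + 1), ← sq]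
    ring
  have hX : (∑ i, v (.inl i)) ^ 2 ≤ (m : ℝ) * ∑ i, v (.inl i) ^ 2 := by
    simpa using sq_sum_le_card_mul_sum_sq (s := Finset.univ) (f := fun i => v (.inl i))
  have hY : (∑ i, v (.inr i)) ^ 2 ≤ (m : ℝ) * ∑ i, v (.inr i) ^ 2 := by
    simpa using sq_sum_le_card_mul_sum_sq (s := Finset.univ) (f := fun i => v (.inr i))
  rw [form, Fintype.sum_sum_type]
  have hm : (0 : ℝ) ≤ (m : ℝ) + 1 := by positivity
  nlinarith [mul_le_mul_of_nonneg_left hX hm, mul_le_mul_of_nonneg_left hY hm,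
    sq_nonneg (∑ i, v (.inl i) - ∑ i, v (.inr i))]

/-- For `m ≥ 1` and `A = [[(m+1)Iₘ, Jₘ],[Jₘ, (m+1)Iₘ]]`, the
`(2m+1)×(2m+1)` matrix `[[2m(m+1)/(2m+1), √(m+1)·𝟙ᵀ],[√(m+1)·𝟙, A]]` is positive
semidefinite; equivalently, `(2m(m+1)/(2m+1))·A − (m+1)·J_{2m}` is positive semidefinite. -/
theorem bordered_matrix_posSemidef
    (m : ℕ) (hm : 1 ≤ m)
    (A : Matrix (Fin m ⊕ Fin m) (Fin m ⊕ Fin m) ℝ)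
    (hA : A = fromBlocks (((m : ℝ) + 1) • 1) (of fun _ _ => 1)
      (of fun _ _ => 1) (((m : ℝ) + 1) • 1)) :
    Matrix.PosSemidef (Matrix.of (fun i j =>
        match i, j with
        | none, none => 2 * (m : ℝ) * ((m : ℝ) + 1) / (2 * (m : ℝ) + 1)
        | none, some _ => Real.sqrt ((m : ℝ) + 1)
        | some _, none => Real.sqrt ((m : ℝ) + 1)
        | some i, some j => A i j) :
      Matrix (Option (Fin m ⊕ Fin m)) (Option (Fin m ⊕ Fin m)) ℝ) ∧
    Matrix.PosSemidef
      ((2 * (m : ℝ) * ((m : ℝ) + 1) / (2 * (m : ℝ) + 1)) • A -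
        ((m : ℝ) + 1) • Matrix.of (fun _ _ => (1 : ℝ))) := by
  have hm0 : (0 : ℝ) < m := by exact_mod_cast hm
  have key (v : Fin m ⊕ Fin m → ℝ) :
      (2 * (m : ℝ) + 1) * (∑ i, v i) ^ 2 ≤ 2 * (m : ℝ) * (v ⬝ᵥ (A *ᵥ v)) :=
    hA ▸ sq_sum_le_dotProduct_fromBlocks_mulVec m v
  have hAsymm : A.IsSymm := by
    subst hA
    exact IsSymm.fromBlocks (isSymm_one.smul _) rfl (isSymm_one.smul _)
  refine ⟨.of_dotProduct_mulVec_nonneg ?_ fun x => ?_,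
    .of_dotProduct_mulVec_nonneg ?_ fun v => ?_⟩
  · ext i j
    rcases i with _ | i <;> rcases j with _ | j <;> simp [hAsymm.apply]
  · set v : Fin m ⊕ Fin m → ℝ := fun i => x (some i) with hv
    set s := Real.sqrt ((m : ℝ) + 1) with hs
    have hs2 : s ^ 2 = (m : ℝ) + 1 := Real.sq_sqrt (by positivity)
    have expand : ∀ c : ℝ, star x ⬝ᵥ ((Matrix.of (fun i j =>
        match i, j with
        | none, none => c
        | none, some _ => s
        | some _, none => s
        | some i, some j => A i j) :
          Matrix (Option (Fin m ⊕ Fin m)) (Option (Fin m ⊕ Fin m)) ℝ) *ᵥ x) =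
        c * x none ^ 2 + 2 * s * x none * (∑ i, v i) + v ⬝ᵥ (A *ᵥ v) := by
      intro c
      simp only [dotProduct, mulVec, Fintype.sum_option, of_apply, Pi.star_apply, star_trivial,
        mul_add, Finset.sum_add_distrib, ← Finset.mul_sum, ← Finset.sum_mul, hv]
      ring
    rw [expand]
    have square : 2 * (m : ℝ) * ((m : ℝ) + 1) / (2 * (m : ℝ) + 1) * x none ^ 2 +
        2 * s * x none * (∑ i, v i) + (2 * (m : ℝ) + 1) / (2 * m) * (∑ i, v i) ^ 2 =
        (2 * (m : ℝ) + 1) / (2 * m) *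
          (∑ i, v i + 2 * m * s * x none / (2 * (m : ℝ) + 1)) ^ 2 := by
      rw [← hs2]
      field_simp
      ring
    have lower : (2 * (m : ℝ) + 1) / (2 * m) * (∑ i, v i) ^ 2 ≤ v ⬝ᵥ (A *ᵥ v) := by
      rw [div_mul_eq_mul_div, div_le_iff₀ (by positivity), mul_comm _ (2 * (m : ℝ))]
      exact key v
    have nonneg : 0 ≤ (2 * (m : ℝ) + 1) / (2 * m) *
        (∑ i, v i + 2 * m * s * x none / (2 * (m : ℝ) + 1)) ^ 2 := by positivity
    linarith
  · ext i j
    simp [hAsymm.apply]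
  · have ones : v ⬝ᵥ (Matrix.of (fun _ _ => (1 : ℝ)) *ᵥ v) = (∑ i, v i) ^ 2 := by
      simp only [dotProduct, mulVec, of_apply, one_mul, ← Finset.sum_mul, sq]
    rw [star_trivial, sub_mulVec, smul_mulVec, smul_mulVec, dotProduct_sub, dotProduct_smul,
      dotProduct_smul, ones, smul_eq_mul, smul_eq_mul, sub_nonneg, div_mul_eq_mul_div,
      le_div_iff₀ (by positivity)]
    have := mul_le_mul_of_nonneg_left (key v) (by positivity : (0 : ℝ) ≤ (m : ℝ) + 1)
    linarith
end
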